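/- Let n ≥ 2 and ρ = 8(n−1). Suppose u₁, u₂ : ℝ² → ℂ^{n−1} (row-vector valued, arguments (t,x)) are smooth and satisfy the coupled vector mKdV system: ∂ₜu₁ − ρ⁻¹∂ₓu₁ = ∂ₓ³u₁ + 3(u₁·ū₁ + u₂·ū₂)∂ₓu₁ + 3(u₂·∂ₓu₁ − ∂ₓu₂·u₁)ū₂ + 3(∂ₓu₁·ū₁ + ∂ₓu₂·ū₂)u₁ and ∂ₜu₂ − ρ⁻¹∂ₓu₂ = ∂ₓ³u₂ + 3(u₁·ū₁ + u₂·ū₂)∂ₓu₂ − 3(u₂·∂ₓu₁ − ∂ₓu₂·u₁)ū₁ + 3(∂ₓu₁·ū₁ + ∂ₓu₂·ū₂)u₂. Then: (i) for any c, d ∈ ℂ with |c|² + |d|² = 1, the pair (v₁, v₂) = (c u₁ + d ū₂, c u₂ − d ū₁) satisfies the same system; (ii) for any 𝐂, 𝐃 ∈ M_{n−1}(ℂ) such that the block matrix [[𝐂, 𝐃],[−𝐃̄, 𝐂̄]] ∈ M_{2(n−1)}(ℂ) is unitary, the pair (v₁, v₂) = (u₁𝐂̄ᵀ + u₂𝐃̄ᵀ,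 −u₁𝐃ᵀ + u₂𝐂ᵀ) satisfies the same system. That is, the system is invariant under the symplectic group Sp(1) × Sp(n−1). -/

import Mathlib

open Matrix Complex

noncomputable section

/-- entrywise complex conjugation of a matrix -/
def mconj {k l : Type*} (M : Matrix k l ℂ) : Matrix k l ℂ := M.map (starRingEnd ℂ)

/-- bilinear dot product x·y = Σᵢ xᵢ yᵢ of row vectors -/
def cdot {ι : Type*} [Fintype ι] (x y : ι → ℂ) : ℂ := ∑ i, x i * y i

/-- entrywise complex conjugate of a row vector -/
def conjv {ι : Type*} (x : ι → ℂ) : ι → ℂ := fun i => star (x i)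

/-- the partial derivative ∂ₜ (first argument) -/
def Dt {ι : Type*} [Fintype ι] (u : ℝ → ℝ → ι → ℂ) : ℝ → ℝ → ι → ℂ :=
  fun t x => deriv (fun s => u s x) t

/-- the partial derivative ∂ₓ (second argument) -/
def Dx {ι : Type*} [Fintype ι] (u : ℝ → ℝ → ι → ℂ) : ℝ → ℝ → ι → ℂ :=
  fun t x => deriv (fun y => u t y) x

/-- the coupled vector mKdV system
∂ₜu₁ − ρ⁻¹∂ₓu₁ = ∂ₓ³u₁ + 3(u₁·ū₁ + u₂·ū₂)∂ₓu₁ + 3(u₂·∂ₓu₁ − ∂ₓu₂·u₁)ū₂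
                 + 3(∂ₓu₁·ū₁ + ∂ₓu₂·ū₂)u₁,
∂ₜu₂ − ρ⁻¹∂ₓu₂ = ∂ₓ³u₂ + 3(u₁·ū₁ + u₂·ū₂)∂ₓu₂ − 3(u₂·∂ₓu₁ − ∂ₓu₂·u₁)ū₁
                 + 3(∂ₓu₁·ū₁ + ∂ₓu₂·ū₂)u₂. -/
def isMKdV {ι : Type*} [Fintype ι] (ρ : ℝ) (u₁ u₂ : ℝ → ℝ → ι → ℂ) : Prop :=
  (∀ t x : ℝ,
    Dt u₁ t x - (ρ : ℂ)⁻¹ • Dx u₁ t x =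
      Dx (Dx (Dx u₁)) t x
      + (3 * (cdot (u₁ t x) (conjv (u₁ t x)) + cdot (u₂ t x) (conjv (u₂ t x)))) • Dx u₁ t x
      + (3 * (cdot (u₂ t x) (Dx u₁ t x) - cdot (Dx u₂ t x) (u₁ t x))) • conjv (u₂ t x)
      + (3 * (cdot (Dx u₁ t x) (conjv (u₁ t x)) + cdot (Dx u₂ t x) (conjv (u₂ t x)))) • u₁ t x)
  ∧ (∀ t x : ℝ,
    Dt u₂ t x - (ρ : ℂ)⁻¹ • Dx u₂ t x =
      Dx (Dx (Dx u₂)) t x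
      + (3 * (cdot (u₁ t x) (conjv (u₁ t x)) + cdot (u₂ t x) (conjv (u₂ t x)))) • Dx u₂ t x
      - (3 * (cdot (u₂ t x) (Dx u₁ t x) - cdot (Dx u₂ t x) (u₁ t x))) • conjv (u₁ t x)
      + (3 * (cdot (Dx u₁ t x) (conjv (u₁ t x)) + cdot (Dx u₂ t x) (conjv (u₂ t x)))) • u₂ t x)

/-- nonlinear part of the first equation -/
def G1 {ι : Type*} [Fintype ι] (a1 a2 b1 b2 : ι → ℂ) : ι → ℂ :=
  (3 * (cdot a1 (conjv a1) + cdot a2 (conjv a2))) • b1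
      + (3 * (cdot a2 b1 - cdot b2 a1)) • conjv a2
      + (3 * (cdot b1 (conjv a1) + cdot b2 (conjv a2))) • a1

/-- nonlinear part of the second equation -/
def G2 {ι : Type*} [Fintype ι] (a1 a2 b1 b2 : ι → ℂ) : ι → ℂ :=
  (3 * (cdot a1 (conjv a1) + cdot a2 (conjv a2))) • b2
      - (3 * (cdot a2 b1 - cdot b2 a1)) • conjv a1
      + (3 * (cdot b1 (conjv a1) + cdot b2 (conjv a2))) • a2

theorem deriv_lin {ι : Type*} [Fintype ι] (V : (ι → ℂ) × (ι → ℂ) →ₗ[ℝ] (ι → ℂ))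
    (f g : ℝ → ι → ℂ) (x : ℝ) (hf : DifferentiableAt ℝ f x) (hg : DifferentiableAt ℝ g x) :
    deriv (fun y => V (f y, g y)) x = V (deriv f x, deriv g x) := by
  have h := hf.hasDerivAt.prodMk hg.hasDerivAt
  have h2 := (LinearMap.toContinuousLinearMap V).hasFDerivAt.comp_hasDerivAt x h
  exact h2.deriv

theorem Dx_lin {ι : Type*} [Fintype ι] (V : (ι → ℂ) × (ι → ℂ) →ₗ[ℝ] (ι → ℂ))
    (f g : ℝ → ℝ → ι → ℂ) (hf : ∀ t, ContDiff ℝ (⊤ : ℕ∞) (f t))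
    (hg : ∀ t, ContDiff ℝ (⊤ : ℕ∞) (g t)) :
    Dx (fun t x => V (f t x, g t x)) = fun t x => V (Dx f t x, Dx g t x) := by
  funext t x
  exact deriv_lin V (f t) (g t) x ((hf t).differentiable (by simp) x)
    ((hg t).differentiable (by simp) x)

theorem Dx_smooth {ι : Type*} [Fintype ι] (f : ℝ → ℝ → ι → ℂ)
    (hf : ∀ t, ContDiff ℝ (⊤ : ℕ∞) (f t)) : ∀ t, ContDiff ℝ (⊤ : ℕ∞) (Dx f t) := fun t =>
  (contDiff_infty_iff_deriv.mp (hf t)).2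

theorem inv_gen {ι : Type*} [Fintype ι] (ρ : ℝ) (u₁ u₂ : ℝ → ℝ → ι → ℂ)
    (hu₁ : ContDiff ℝ (⊤ : ℕ∞) (fun p : ℝ × ℝ => u₁ p.1 p.2))
    (hu₂ : ContDiff ℝ (⊤ : ℕ∞) (fun p : ℝ × ℝ => u₂ p.1 p.2))
    (hsys : isMKdV ρ u₁ u₂)
    (V1 V2 : (ι → ℂ) × (ι → ℂ) →ₗ[ℝ] (ι → ℂ))
    (h1 : ∀ a1 a2 b1 b2, G1 (V1 (a1, a2)) (V2 (a1, a2)) (V1 (b1, b2)) (V2 (b1, b2))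
      = V1 (G1 a1 a2 b1 b2, G2 a1 a2 b1 b2))
    (h2 : ∀ a1 a2 b1 b2, G2 (V1 (a1, a2)) (V2 (a1, a2)) (V1 (b1, b2)) (V2 (b1, b2))
      = V2 (G1 a1 a2 b1 b2, G2 a1 a2 b1 b2)) :
    isMKdV ρ (fun t x => V1 (u₁ t x, u₂ t x)) (fun t x => V2 (u₁ t x, u₂ t x)) := by
  have s1 : ∀ t, ContDiff ℝ (⊤ : ℕ∞) (u₁ t) := fun t =>
    hu₁.comp (contDiff_const.prodMk contDiff_id : ContDiff ℝ (⊤ : ℕ∞) (fun x : ℝ => (t, x)))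
  have s2 : ∀ t, ContDiff ℝ (⊤ : ℕ∞) (u₂ t) := fun t =>
    hu₂.comp (contDiff_const.prodMk contDiff_id : ContDiff ℝ (⊤ : ℕ∞) (fun x : ℝ => (t, x)))
  have r1 : ∀ x, ContDiff ℝ (⊤ : ℕ∞) (fun t => u₁ t x) := fun x =>
    hu₁.comp (contDiff_id.prodMk contDiff_const : ContDiff ℝ (⊤ : ℕ∞) (fun t : ℝ => (t, x)))
  have r2 : ∀ x, ContDiff ℝ (⊤ : ℕ∞) (fun t => u₂ t x) := fun x =>
    hu₂.comp (contDiff_id.prodMk contDiff_const : ContDiff ℝ (⊤ : ℕ∞) (fun t : ℝ => (t, x)))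
  have eDt : ∀ V : (ι → ℂ) × (ι → ℂ) →ₗ[ℝ] (ι → ℂ), ∀ t x,
      Dt (fun t x => V (u₁ t x, u₂ t x)) t x = V (Dt u₁ t x, Dt u₂ t x) := fun V t x =>
    deriv_lin V (fun s => u₁ s x) (fun s => u₂ s x) t ((r1 x).differentiable (by simp) t)
      ((r2 x).differentiable (by simp) t)
  have eDx := fun V : (ι → ℂ) × (ι → ℂ) →ₗ[ℝ] (ι → ℂ) => Dx_lin V u₁ u₂ s1 s2
  have eDx3 : ∀ V : (ι → ℂ) × (ι → ℂ) →ₗ[ℝ] (ι → ℂ),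
      Dx (Dx (Dx (fun t x => V (u₁ t x, u₂ t x))))
        = fun t x => V (Dx (Dx (Dx u₁)) t x, Dx (Dx (Dx u₂)) t x) := by
    intro V
    rw [eDx, Dx_lin V _ _ (Dx_smooth _ s1) (Dx_smooth _ s2),
      Dx_lin V _ _ (Dx_smooth _ (Dx_smooth _ s1)) (Dx_smooth _ (Dx_smooth _ s2))]
  have hs : ∀ v : ι → ℂ, (ρ : ℂ)⁻¹ • v = (ρ⁻¹ : ℝ) • v := by
    intro v; ext i; simp
  have e1 : ∀ t x, Dt u₁ t x = Dx (Dx (Dx u₁)) t x + (ρ⁻¹ : ℝ) • Dx u₁ t x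
      + G1 (u₁ t x) (u₂ t x) (Dx u₁ t x) (Dx u₂ t x) := by
    intro t x
    rw [← hs, sub_eq_iff_eq_add.mp (hsys.1 t x), G1]; abel
  have e2 : ∀ t x, Dt u₂ t x = Dx (Dx (Dx u₂)) t x + (ρ⁻¹ : ℝ) • Dx u₂ t x
      + G2 (u₁ t x) (u₂ t x) (Dx u₁ t x) (Dx u₂ t x) := by
    intro t x
    rw [← hs, sub_eq_iff_eq_add.mp (hsys.2 t x), G2]; abel
  have key : ∀ V : (ι → ℂ) × (ι → ℂ) →ₗ[ℝ] (ι → ℂ), ∀ t x,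
      Dt (fun t x => V (u₁ t x, u₂ t x)) t x
        - (ρ : ℂ)⁻¹ • Dx (fun t x => V (u₁ t x, u₂ t x)) t x
      = Dx (Dx (Dx (fun t x => V (u₁ t x, u₂ t x)))) t x
        + V (G1 (u₁ t x) (u₂ t x) (Dx u₁ t x) (Dx u₂ t x),
            G2 (u₁ t x) (u₂ t x) (Dx u₁ t x) (Dx u₂ t x)) := by
    intro V t x
    rw [eDt, eDx3, eDx, hs, e1, e2, ← Prod.mk_add_mk, ← Prod.mk_add_mk, ← Prod.smul_mk,
      map_add, map_add, map_smul]
    abel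
  constructor
  · intro t x
    rw [key, ← h1, eDx, eDx, G1]
    abel
  · intro t x
    rw [key, ← h2, eDx, eDx, G2]
    abel

section cd
variable {ι : Type*} [Fintype ι]
theorem cdot_add_l (x y z : ι → ℂ) : cdot (x + y) z = cdot x z + cdot y z := by
  simp [cdot, add_mul, Finset.sum_add_distrib]
theorem cdot_add_r (x y z : ι → ℂ) : cdot z (x + y) = cdot z x + cdot z y := by
  simp [cdot, mul_add, Finset.sum_add_distrib]
theorem cdot_sub_l (x y z : ι → ℂ) : cdot (x - y) z = cdot x z - cdot y z := by
  simp [cdot, sub_mul, Finset.sum_sub_distrib]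
theorem cdot_sub_r (x y z : ι → ℂ) : cdot z (x - y) = cdot z x - cdot z y := by
  simp [cdot, mul_sub, Finset.sum_sub_distrib]
theorem cdot_smul_l (c : ℂ) (x z : ι → ℂ) : cdot (c • x) z = c * cdot x z := by
  simp [cdot, Finset.mul_sum, mul_assoc]
theorem cdot_smul_r (c : ℂ) (x z : ι → ℂ) : cdot z (c • x) = c * cdot z x := by
  simp [cdot, Finset.mul_sum, mul_left_comm]
theorem conjv_add (x y : ι → ℂ) : conjv (x + y) = conjv x + conjv y := by
  ext i; simp [conjv]
theorem conjv_sub (x y : ι → ℂ) : conjv (x - y) = conjv x - conjv y := by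
  ext i; simp [conjv]
theorem conjv_neg (x : ι → ℂ) : conjv (-x) = -conjv x := by
  ext i; simp [conjv]
theorem conjv_smul (c : ℂ) (x : ι → ℂ) : conjv (c • x) = star c • conjv x := by
  ext i; simp [conjv]
theorem conjv_conjv (x : ι → ℂ) : conjv (conjv x) = x := by
  ext i; simp [conjv]
theorem star_cdot (x y : ι → ℂ) : star (cdot x y) = cdot (conjv x) (conjv y) := by
  simp [conjv, cdot]
theorem cdot_comm' (x y : ι → ℂ) : cdot x y = cdot y x := by
  simp [cdot, mul_comm]

/-- the Sp(1) map, first component -/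
def W1 (c d : ℂ) : (ι → ℂ) × (ι → ℂ) →ₗ[ℝ] (ι → ℂ) where
  toFun p := c • p.1 + d • conjv p.2
  map_add' p q := by ext i; simp [conjv]; ring
  map_smul' r q := by ext i; simp [conjv]; ring
/-- the Sp(1) map, second component -/
def W2 (c d : ℂ) : (ι → ℂ) × (ι → ℂ) →ₗ[ℝ] (ι → ℂ) where
  toFun p := c • p.2 - d • conjv p.1
  map_add' p q := by ext i; simp [conjv]; ring
  map_smul' r q := by ext i; simp [conjv]; ring

theorem W1_apply (c d : ℂ) (a b : ι → ℂ) : W1 c d (a, b) = c • a + d • conjv b := rfl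
theorem W2_apply (c d : ℂ) (a b : ι → ℂ) : W2 c d (a, b) = c • b - d • conjv a := rfl

theorem Nid (c d : ℂ) (h : c * star c + d * star d = 1) (a1 a2 : ι → ℂ) :
    cdot (W1 c d (a1, a2)) (conjv (W1 c d (a1, a2)))
      + cdot (W2 c d (a1, a2)) (conjv (W2 c d (a1, a2)))
    = cdot a1 (conjv a1) + cdot a2 (conjv a2) := by
  simp only [W1_apply, W2_apply, cdot_add_l, cdot_add_r, cdot_sub_l, cdot_sub_r, cdot_smul_l,
    cdot_smul_r, conjv_add, conjv_sub, conjv_smul, conjv_conjv]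
  rw [cdot_comm' (conjv a2) a2, cdot_comm' (conjv a1) a1, cdot_comm' (conjv a2) (conjv a1),
    cdot_comm' a2 a1]
  linear_combination (cdot a1 (conjv a1) + cdot a2 (conjv a2)) * h

theorem Aid (c d : ℂ) (a1 a2 b1 b2 : ι → ℂ) :
    cdot (W2 c d (a1, a2)) (W1 c d (b1, b2)) - cdot (W2 c d (b1, b2)) (W1 c d (a1, a2))
    = c ^ 2 * (cdot a2 b1 - cdot b2 a1)
      + c * d * (star (cdot b1 (conjv a1) + cdot b2 (conjv a2))
          - (cdot b1 (conjv a1) + cdot b2 (conjv a2)))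
      + d ^ 2 * star (cdot a2 b1 - cdot b2 a1) := by
  simp only [W1_apply, W2_apply, cdot_add_l, cdot_add_r, cdot_sub_l, cdot_sub_r, cdot_smul_l,
    cdot_smul_r, conjv_add, conjv_sub, conjv_smul, conjv_conjv, star_add, star_sub, star_cdot]
  rw [cdot_comm' (conjv a1) b1, cdot_comm' a2 (conjv b2), cdot_comm' (conjv a1) (conjv b2),
    cdot_comm' (conjv b1) (conjv a2)]
  ring

theorem Bid (c d : ℂ) (a1 a2 b1 b2 : ι → ℂ) :
    cdot (W1 c d (b1, b2)) (conjv (W1 c d (a1, a2)))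
      + cdot (W2 c d (b1, b2)) (conjv (W2 c d (a1, a2)))
    = c * star c * (cdot b1 (conjv a1) + cdot b2 (conjv a2))
      + d * star d * star (cdot b1 (conjv a1) + cdot b2 (conjv a2))
      + c * star d * (cdot a2 b1 - cdot b2 a1)
      - d * star c * star (cdot a2 b1 - cdot b2 a1) := by
  simp only [W1_apply, W2_apply, cdot_add_l, cdot_add_r, cdot_sub_l, cdot_sub_r, cdot_smul_l,
    cdot_smul_r, conjv_add, conjv_sub, conjv_smul, conjv_conjv, star_add, star_sub, star_cdot]
  rw [cdot_comm' a2 b1, cdot_comm' (conjv a2) (conjv b1)]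
  ring

theorem star_N (a1 a2 : ι → ℂ) : star (cdot a1 (conjv a1) + cdot a2 (conjv a2))
    = cdot a1 (conjv a1) + cdot a2 (conjv a2) := by
  rw [star_add, star_cdot, star_cdot, conjv_conjv, conjv_conjv, cdot_comm' a1, cdot_comm' a2]

theorem W_G1 (c d : ℂ) (h : c * star c + d * star d = 1) (a1 a2 b1 b2 : ι → ℂ) :
    G1 (W1 c d (a1, a2)) (W2 c d (a1, a2)) (W1 c d (b1, b2)) (W2 c d (b1, b2))
      = W1 c d (G1 a1 a2 b1 b2, G2 a1 a2 b1 b2) := by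
  have hN := star_N a1 a2
  unfold G1 G2
  rw [Nid c d h, Aid, Bid]
  generalize cdot a1 (conjv a1) + cdot a2 (conjv a2) = N at *
  generalize cdot a2 b1 - cdot b2 a1 = A at *
  generalize cdot b1 (conjv a1) + cdot b2 (conjv a2) = B at *
  ext i
  simp only [W1_apply, W2_apply, conjv, Pi.add_apply, Pi.sub_apply, Pi.smul_apply, smul_eq_mul,
    star_add, star_sub, star_mul', star_star, hN, star_ofNat]
  linear_combination (3 * c * B * a1 i - 3 * d * star A * a1 i + 3 * c * A * star (a2 i)
    + 3 * d * star B * star (a2 i)) * h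

theorem W_G2 (c d : ℂ) (h : c * star c + d * star d = 1) (a1 a2 b1 b2 : ι → ℂ) :
    G2 (W1 c d (a1, a2)) (W2 c d (a1, a2)) (W1 c d (b1, b2)) (W2 c d (b1, b2))
      = W2 c d (G1 a1 a2 b1 b2, G2 a1 a2 b1 b2) := by
  have hN := star_N a1 a2
  unfold G1 G2
  rw [Nid c d h, Aid, Bid]
  generalize cdot a1 (conjv a1) + cdot a2 (conjv a2) = N at *
  generalize cdot a2 b1 - cdot b2 a1 = A at *
  generalize cdot b1 (conjv a1) + cdot b2 (conjv a2) = B at *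
  ext i
  simp only [W1_apply, W2_apply, conjv, Pi.add_apply, Pi.sub_apply, Pi.smul_apply, smul_eq_mul,
    star_add, star_sub, star_mul', star_star, hN, star_ofNat]
  linear_combination (3 * c * B * a2 i - 3 * d * star A * a2 i - 3 * c * A * star (a1 i)
    - 3 * d * star B * star (a1 i)) * h

/-- the Sp(n-1) map, first component -/
def U1 (C D : Matrix ι ι ℂ) : (ι → ℂ) × (ι → ℂ) →ₗ[ℂ] (ι → ℂ) where
  toFun p := Matrix.vecMul p.1 ((mconj C)ᵀ) + Matrix.vecMul p.2 ((mconj D)ᵀ)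
  map_add' p q := by simp only [Prod.fst_add, Prod.snd_add, add_vecMul]; abel
  map_smul' r q := by simp [smul_vecMul]
/-- the Sp(n-1) map, second component -/
def U2 (C D : Matrix ι ι ℂ) : (ι → ℂ) × (ι → ℂ) →ₗ[ℂ] (ι → ℂ) where
  toFun p := -(Matrix.vecMul p.1 (Dᵀ)) + Matrix.vecMul p.2 (Cᵀ)
  map_add' p q := by simp only [Prod.fst_add, Prod.snd_add, add_vecMul]; abel
  map_smul' r q := by simp [smul_vecMul]

theorem U1_apply (C D : Matrix ι ι ℂ) (a b : ι → ℂ) : U1 C D (a, b)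
  = Matrix.vecMul a ((mconj C)ᵀ) + Matrix.vecMul b ((mconj D)ᵀ) := rfl
theorem U2_apply (C D : Matrix ι ι ℂ) (a b : ι → ℂ) : U2 C D (a, b)
  = -(Matrix.vecMul a (Dᵀ)) + Matrix.vecMul b (Cᵀ) := rfl

theorem U_elim (C D : Matrix ι ι ℂ) (a b : ι → ℂ) :
    Sum.elim (U1 C D (a, b)) (U2 C D (a, b))
      = Matrix.vecMul (Sum.elim a b) (fromBlocks C D (-(mconj D)) (mconj C))ᴴ := by
  rw [fromBlocks_conjTranspose, vecMul_fromBlocks]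
  have e1 : Cᴴ = (mconj C)ᵀ := rfl
  have e2 : Dᴴ = (mconj D)ᵀ := rfl
  have e3 : (-(mconj D))ᴴ = -Dᵀ := by ext i j; simp [mconj]
  have e4 : (mconj C)ᴴ = Cᵀ := by ext i j; simp [mconj]
  rw [e1, e2, e3, e4, U1_apply, U2_apply]
  simp [vecMul_neg]

theorem cdot_sum (a b x y : ι → ℂ) :
    cdot a (conjv x) + cdot b (conjv y) = Sum.elim a b ⬝ᵥ star (Sum.elim x y) := by
  simp [cdot, conjv, dotProduct]

theorem U_H [DecidableEq ι] (C D : Matrix ι ι ℂ)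
    (h : (fromBlocks C D (-(mconj D)) (mconj C))ᴴ * fromBlocks C D (-(mconj D)) (mconj C) = 1)
    (a1 a2 b1 b2 : ι → ℂ) :
    cdot (U1 C D (b1, b2)) (conjv (U1 C D (a1, a2)))
      + cdot (U2 C D (b1, b2)) (conjv (U2 C D (a1, a2)))
    = cdot b1 (conjv a1) + cdot b2 (conjv a2) := by
  rw [cdot_sum, cdot_sum, U_elim, U_elim, star_vecMul, conjTranspose_conjTranspose,
    dotProduct_mulVec, vecMul_vecMul, h, vecMul_one]

theorem conjv_vecMul (a : ι → ℂ) (M : Matrix ι ι ℂ) :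
    conjv (Matrix.vecMul a M) = Matrix.vecMul (conjv a) (mconj M) := by
  ext i; simp [conjv, mconj, vecMul, dotProduct]

theorem U1_J (C D : Matrix ι ι ℂ) (a1 a2 : ι → ℂ) :
    U1 C D (conjv a2, -conjv a1) = conjv (U2 C D (a1, a2)) := by
  rw [U1_apply, U2_apply, conjv_add, conjv_neg, conjv_vecMul, conjv_vecMul, neg_vecMul]
  exact add_comm _ _

theorem U2_J (C D : Matrix ι ι ℂ) (a1 a2 : ι → ℂ) :
    U2 C D (conjv a2, -conjv a1) = -conjv (U1 C D (a1, a2)) := by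
  have e : ∀ M : Matrix ι ι ℂ, mconj (mconj M)ᵀ = Mᵀ := by
    intro M; ext i j; simp [mconj]
  rw [U1_apply, U2_apply, conjv_add, conjv_vecMul, conjv_vecMul, neg_vecMul, e, e]
  abel

theorem U_A [DecidableEq ι] (C D : Matrix ι ι ℂ)
    (h : (fromBlocks C D (-(mconj D)) (mconj C))ᴴ * fromBlocks C D (-(mconj D)) (mconj C) = 1)
    (a1 a2 b1 b2 : ι → ℂ) :
    cdot (U2 C D (a1, a2)) (U1 C D (b1, b2)) - cdot (U2 C D (b1, b2)) (U1 C D (a1, a2))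
    = cdot a2 b1 - cdot b2 a1 := by
  have e : ∀ x y : ι → ℂ, cdot x (-y) = - cdot x y := by intro x y; simp [cdot]
  have := U_H C D h (conjv a2) (-conjv a1) b1 b2
  rw [U1_J, U2_J] at this
  simp only [conjv_neg, conjv_conjv, e, ← sub_eq_add_neg] at this
  rw [cdot_comm' _ (U1 C D (b1, b2)), this, cdot_comm' b1]

theorem U_G1 [DecidableEq ι] (C D : Matrix ι ι ℂ)
    (h : (fromBlocks C D (-(mconj D)) (mconj C))ᴴ * fromBlocks C D (-(mconj D)) (mconj C) = 1)
    (a1 a2 b1 b2 : ι → ℂ) :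
    G1 (U1 C D (a1, a2)) (U2 C D (a1, a2)) (U1 C D (b1, b2)) (U2 C D (b1, b2))
      = U1 C D (G1 a1 a2 b1 b2, G2 a1 a2 b1 b2) := by
  unfold G1 G2
  rw [U_H C D h, U_H C D h, U_A C D h, ← U1_J, ← map_smul, ← map_smul, ← map_smul, ← map_add,
    ← map_add]
  simp only [Prod.smul_mk, Prod.mk_add_mk, smul_neg, sub_eq_add_neg]

theorem U_G2 [DecidableEq ι] (C D : Matrix ι ι ℂ)
    (h : (fromBlocks C D (-(mconj D)) (mconj C))ᴴ * fromBlocks C D (-(mconj D)) (mconj C) = 1)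
    (a1 a2 b1 b2 : ι → ℂ) :
    G2 (U1 C D (a1, a2)) (U2 C D (a1, a2)) (U1 C D (b1, b2)) (U2 C D (b1, b2))
      = U2 C D (G1 a1 a2 b1 b2, G2 a1 a2 b1 b2) := by
  unfold G1 G2
  rw [U_H C D h, U_H C D h, U_A C D h, sub_eq_add_neg, ← smul_neg, ← U2_J, ← map_smul, ← map_smul,
    ← map_smul, ← map_add, ← map_add]
  simp only [Prod.smul_mk, Prod.mk_add_mk, smul_neg, sub_eq_add_neg]

end cd

/-- the coupled vector mKdV system with ρ = 8(n−1) is invariant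
under the symplectic group Sp(1) × Sp(n−1): (i) the Sp(1)-action
(u₁,u₂) ↦ (c u₁ + d ū₂, c u₂ − d ū₁) with |c|² + |d|² = 1 maps solutions to
solutions; (ii) the Sp(n−1)-action (u₁,u₂) ↦ (u₁𝐂̄ᵀ + u₂𝐃̄ᵀ, −u₁𝐃ᵀ + u₂𝐂ᵀ),
where [[𝐂,𝐃],[−𝐃̄,𝐂̄]] is unitary, maps solutions to solutions. -/
theorem stmt11 (n : ℕ) (hn : 2 ≤ n)
    (u₁ u₂ : ℝ → ℝ → Fin (n - 1) → ℂ)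
    (hu₁ : ContDiff ℝ (⊤ : ℕ∞) (fun p : ℝ × ℝ => u₁ p.1 p.2))
    (hu₂ : ContDiff ℝ (⊤ : ℕ∞) (fun p : ℝ × ℝ => u₂ p.1 p.2))
    (hsys : isMKdV (8 * ((n : ℝ) - 1)) u₁ u₂) :
    (∀ c d : ℂ, c * star c + d * star d = 1 →
      isMKdV (8 * ((n : ℝ) - 1))
        (fun t x j => c * u₁ t x j + d * star (u₂ t x j))
        (fun t x j => c * u₂ t x j - d * star (u₁ t x j))) ∧
    (∀ C D : Matrix (Fin (n - 1)) (Fin (n - 1)) ℂ,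
      (fromBlocks C D (-(mconj D)) (mconj C))ᴴ * fromBlocks C D (-(mconj D)) (mconj C) = 1 →
      isMKdV (8 * ((n : ℝ) - 1))
        (fun t x => Matrix.vecMul (u₁ t x) ((mconj C)ᵀ) + Matrix.vecMul (u₂ t x) ((mconj D)ᵀ))
        (fun t x => -(Matrix.vecMul (u₁ t x) (Dᵀ)) + Matrix.vecMul (u₂ t x) (Cᵀ))) := by
  refine ⟨fun c d h => ?_, fun C D h => ?_⟩
  · exact inv_gen _ u₁ u₂ hu₁ hu₂ hsys (W1 c d) (W2 c d) (W_G1 c d h) (W_G2 c d h)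
  · exact inv_gen _ u₁ u₂ hu₁ hu₂ hsys ((U1 C D).restrictScalars ℝ)
      ((U2 C D).restrictScalars ℝ) (U_G1 C D h) (U_G2 C D h)
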